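/- arXiv:cs/0609166 — 6 statements merged into one kernel-verified Lean document; each statement's English description precedes it below -/
import Mathlib

section
/- Let ε > 0 and let c̃ be the vector that agrees with c on the qualified index set Q_{c,B,ε/(B(1+ε))} and is zero elsewhere. Then ‖c̃ − c‖₂² ≤ (1+ε)·‖c_opt − c‖₂². -/
/-- The tail sum `∑_{i=j}^{N-1} c_i²`. -/
noncomputable def tailSum (N : ℕ) (c : Fin N → ℝ) (j : ℕ) : ℝ :=
  ∑ i ∈ Finset.univ.filter (fun i : Fin N => j ≤ (i : ℕ)), c i ^ 2

/-- The qualified length `m(c,ℓ,θ)`: the least `j < ℓ` with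
`c_j² < θ·∑_{i=j}^{N-1} c_i²`, or `ℓ` if no such `j` exists. -/
noncomputable def qualLen (N : ℕ) (c : Fin N → ℝ) (ℓ : ℕ) (θ : ℝ) : ℕ :=
  sInf ({j : ℕ | ∃ hj : j < N, j < ℓ ∧ c ⟨j, hj⟩ ^ 2 < θ * tailSum N c j} ∪ {ℓ})

theorem sum_truncation_sub_sq (N : ℕ) (c : Fin N → ℝ) (k : ℕ) :
    ∑ i : Fin N, ((if (i : ℕ) < k then c i else 0) - c i) ^ 2 = tailSum N c k := by
  rw [tailSum, Finset.sum_filter]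
  refine Finset.sum_congr rfl fun i _ => ?_
  by_cases h : (i : ℕ) < k
  · simp [h]
  · simp [h, not_lt.mp h]

/-- The qualified length is either `ℓ` or an index at which qualification fails. -/
theorem qualLen_mem (N : ℕ) (c : Fin N → ℝ) (ℓ : ℕ) (θ : ℝ) :
    qualLen N c ℓ θ ∈
      {j : ℕ | ∃ hj : j < N, j < ℓ ∧ c ⟨j, hj⟩ ^ 2 < θ * tailSum N c j} ∪ {ℓ} :=
  Nat.sInf_mem ⟨ℓ, Or.inr rfl⟩

/-- For a vector sorted by magnitude, moving the start of a tail from `B` down to `m` adds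
at most `B` terms, each bounded by `c_m²`. -/
theorem tailSum_le_mul_sq_add_tailSum {N : ℕ} (B : ℕ) {c : Fin N → ℝ}
    (hsorted : ∀ i j : Fin N, i ≤ j → |c j| ≤ |c i|) (m : Fin N) :
    tailSum N c m ≤ B * c m ^ 2 + tailSum N c B := by
  have hsplit : tailSum N c m ≤
      ∑ _i ∈ Finset.univ.filter (fun i : Fin N => (i : ℕ) < B), c m ^ 2 + tailSum N c B := by
    simp only [tailSum, Finset.sum_filter]
    rw [← Finset.sum_add_distrib]
    refine Finset.sum_le_sum fun i _ => ?_
    have hi : m ≤ i → c i ^ 2 ≤ c m ^ 2 := fun h => sq_le_sq.mpr (hsorted m i h)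
    have := sq_nonneg (c m)
    have := sq_nonneg (c i)
    rw [Fin.le_def] at hi
    split_ifs <;> first | omega | linarith | linarith [hi ‹_›]
  have hcard : (Finset.univ.filter fun i : Fin N => (i : ℕ) < B).card ≤ B := by
    simpa using Finset.card_le_card_of_injOn (t := Finset.range B) (fun i : Fin N => (i : ℕ))
      (fun i hi => by simpa using hi) (Fin.val_injective.injOn)
  refine hsplit.trans ?_
  rw [Finset.sum_const, nsmul_eq_mul]
  gcongr

/-- Restricting `c` to the qualified index set `Q_{c,B,ε/(B(1+ε))}` gives squared
Euclidean error at most `(1+ε)` times that of the best `B`-term approximation. -/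
theorem qualified_prefix_is_good (N B : ℕ) (hN : 0 < N) (hB : 0 < B) (hBN : B ≤ N)
    (c : Fin N → ℝ)
    (hsorted : ∀ i j : Fin N, i ≤ j → |c j| ≤ |c i|)
    (ε : ℝ) (hε : 0 < ε) :
    ∑ i : Fin N,
        ((if (i : ℕ) < qualLen N c B (ε / (B * (1 + ε))) then c i else 0) - c i) ^ 2
      ≤ (1 + ε) * ∑ i : Fin N, ((if (i : ℕ) < B then c i else 0) - c i) ^ 2 := by
  rw [sum_truncation_sub_sq, sum_truncation_sub_sq]
  have htail : 0 ≤ tailSum N c B := Finset.sum_nonneg fun i _ => sq_nonneg (c i)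
  rcases qualLen_mem N c B (ε / (B * (1 + ε))) with ⟨hmN, -, hlt⟩ | hm
  · generalize qualLen N c B (ε / (B * (1 + ε))) = m at hmN hlt ⊢
    have hB' : (0 : ℝ) < B := by exact_mod_cast hB
    have hbound := tailSum_le_mul_sq_add_tailSum B hsorted ⟨m, hmN⟩
    rw [div_mul_eq_mul_div, lt_div_iff₀ (by positivity)] at hlt
    have := mul_le_mul_of_nonneg_left hbound (show 0 ≤ 1 + ε by positivity)
    dsimp only at this
    linarith
  · rw [Set.mem_singleton_iff.mp hm]
    nlinarith
end

section
/- Let ε > 0, set θ = ε/(B(1+ε)) and θ' = ε/(B(1+ε)²), and suppose s_0,…,s_{B−1} are real numbers satisfying (1/(1+ε))·Σ_{i=j}^{N−1} c_i² ≤ s_j ≤ Σ_{i=j}^{N−1} c_i² for each j < B. Define the output set as the longest prefix {0,…,m−1} with m ≤ B such that c_j² ≥ θ·s_j for all j < m. Then the output set is a prefix of (in particular, contained in) the qualified index set Q_{c,B,θ'}. -/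
/-- The output length of the protocol: the longest `m ≤ B` such that the test
`c_j² ≥ θ·s_j` passes for all `j < m`. -/
noncomputable def outLen (N B : ℕ) (c : Fin N → ℝ) (θ : ℝ) (s : ℕ → ℝ) : ℕ :=
  sSup {m : ℕ | m ≤ B ∧ ∀ j : Fin N, (j : ℕ) < m → θ * s j ≤ c j ^ 2}

/-- If each `s_j` is a `(1+ε)`-underestimate of the tail sum `∑_{i=j}^{N-1} c_i²`,
then the output set (for threshold `θ = ε/(B(1+ε))`) is a prefix of — in particular
contained in — the qualified set `Q_{c,B,θ'}` with `θ' = ε/(B(1+ε)²)`. -/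
theorem output_prefix_of_qualified (N B : ℕ) (hN : 0 < N) (hB : 0 < B) (hBN : B ≤ N)
    (c : Fin N → ℝ)
    (hsorted : ∀ i j : Fin N, i ≤ j → |c j| ≤ |c i|)
    (ε : ℝ) (hε : 0 < ε) (s : ℕ → ℝ)
    (hs : ∀ j : ℕ, j < B → tailSum N c j / (1 + ε) ≤ s j ∧ s j ≤ tailSum N c j) :
    outLen N B c (ε / (B * (1 + ε))) s
      ≤ qualLen N c B (ε / (B * (1 + ε) ^ 2)) := by
  refine csSup_le ⟨0, Nat.zero_le B, fun j hj => absurd hj (Nat.not_lt_zero _)⟩ ?_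
  rintro m ⟨hmB, hm⟩
  refine le_csInf ⟨B, Or.inr rfl⟩ ?_
  rintro j (⟨hjN, hjB, hlt⟩ | rfl)
  · by_contra! hjm
    have hB' : (0 : ℝ) < B := Nat.cast_pos.mpr hB
    refine hlt.not_ge ?_
    calc ε / (B * (1 + ε) ^ 2) * tailSum N c j
        = ε / (B * (1 + ε)) * (tailSum N c j / (1 + ε)) := by field_simp
      _ ≤ ε / (B * (1 + ε)) * s j := by gcongr; exact (hs j hjB).1
      _ ≤ c ⟨j, hjN⟩ ^ 2 := hm ⟨j, hjN⟩ hjm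
  · exact hmB
end

section
/- Let ε > 0 and suppose the qualified length m = m(c,B,ε/(B(1+ε))) is strictly less than B. Then the tail of the top-B block is small: Σ_{j=m}^{B−1} c_j² < ε·Σ_{j=B}^{N−1} c_j². -/
/-- A qualified length below `ℓ` is attained at an index satisfying the defining inequality. -/
lemma sq_lt_of_qualLen_lt {N : ℕ} {c : Fin N → ℝ} {ℓ : ℕ} {θ : ℝ} (h : qualLen N c ℓ θ < ℓ) :
    ∃ hj : qualLen N c ℓ θ < N,
      c ⟨qualLen N c ℓ θ, hj⟩ ^ 2 < θ * tailSum N c (qualLen N c ℓ θ) := by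
  have hmem : qualLen N c ℓ θ ∈
      {j : ℕ | ∃ hj : j < N, j < ℓ ∧ c ⟨j, hj⟩ ^ 2 < θ * tailSum N c j} ∪ {ℓ} :=
    Nat.sInf_mem ⟨ℓ, Or.inr rfl⟩
  rcases hmem with ⟨hj, -, hlt⟩ | heq
  · exact ⟨hj, hlt⟩
  · exact absurd heq h.ne

/-- A tail sum splits into a block and a later tail. -/
lemma tailSum_eq_block_add {N : ℕ} (c : Fin N → ℝ) {m B : ℕ} (h : m ≤ B) :
    tailSum N c m =
      ∑ i ∈ Finset.univ.filter (fun i : Fin N => m ≤ (i : ℕ) ∧ (i : ℕ) < B), c i ^ 2 +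
        tailSum N c B := by
  unfold tailSum
  rw [← Finset.sum_filter_add_sum_filter_not _ (fun i : Fin N => (i : ℕ) < B),
    Finset.filter_filter, Finset.filter_filter]
  congr 2
  ext i
  simp only [Finset.mem_filter, Finset.mem_univ, true_and]
  omega

/-- For entries sorted by magnitude, a block ending before `B` is at most `B` times the square
of its first entry. -/
lemma block_le_mul_sq {N : ℕ} {c : Fin N → ℝ}
    (hsorted : ∀ i j : Fin N, i ≤ j → |c j| ≤ |c i|) {m : ℕ} (hm : m < N) (B : ℕ) :
    ∑ i ∈ Finset.univ.filter (fun i : Fin N => m ≤ (i : ℕ) ∧ (i : ℕ) < B), c i ^ 2 ≤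
      B * c ⟨m, hm⟩ ^ 2 := by
  have hcard : (Finset.univ.filter (fun i : Fin N => m ≤ (i : ℕ) ∧ (i : ℕ) < B)).card ≤ B := by
    calc _ ≤ (Finset.range B).card :=
          Finset.card_le_card_of_injOn Fin.val
            (fun i hi => by simp at hi ⊢; exact hi.2) Fin.val_injective.injOn
      _ = B := Finset.card_range B
  refine (Finset.sum_le_card_nsmul _ _ (c ⟨m, hm⟩ ^ 2) fun i hi => ?_).trans ?_
  · exact sq_le_sq.mpr (hsorted ⟨m, hm⟩ i (Finset.mem_filter.mp hi).2.1)
  · rw [nsmul_eq_mul]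
    gcongr

/-- If the qualified length `m = m(c,B,ε/(B(1+ε)))` is strictly less than `B`, then
the tail of the top-`B` block is small: `∑_{j=m}^{B-1} c_j² < ε·∑_{j=B}^{N-1} c_j²`. -/
theorem small_tail_of_short_qualified (N B : ℕ) (hN : 0 < N) (hB : 0 < B) (hBN : B ≤ N)
    (c : Fin N → ℝ)
    (hsorted : ∀ i j : Fin N, i ≤ j → |c j| ≤ |c i|)
    (ε : ℝ) (hε : 0 < ε)
    (hm : qualLen N c B (ε / (B * (1 + ε))) < B) :
    ∑ i ∈ Finset.univ.filter
        (fun i : Fin N => qualLen N c B (ε / (B * (1 + ε))) ≤ (i : ℕ) ∧ (i : ℕ) < B),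
        c i ^ 2
      < ε * ∑ i ∈ Finset.univ.filter (fun i : Fin N => B ≤ (i : ℕ)), c i ^ 2 := by
  obtain ⟨hmN, hlt⟩ := sq_lt_of_qualLen_lt hm
  have hblock := block_le_mul_sq hsorted hmN B
  rw [tailSum_eq_block_add c hm.le] at hlt
  have hB' : (0 : ℝ) < B := Nat.cast_pos.mpr hB
  rw [div_mul_eq_mul_div, lt_div_iff₀ (by positivity)] at hlt
  change _ < ε * tailSum N c B
  have hscaled := mul_le_mul_of_nonneg_right hblock (by positivity : 0 ≤ 1 + ε)
  linarith
end

section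
/- Let ε > 0 and let S = {0,…,m−1} be any prefix with m(c,B,ε/(B(1+ε))) ≤ m ≤ B, and let c̃ = c·1_S. Then the taxicab error satisfies ‖c − c̃‖₁ ≤ (1 + √(B·ε))·‖c − c_opt‖₁. -/
theorem Fin.sum_ite_val_lt_const {N B : ℕ} (hBN : B ≤ N) (a : ℝ) :
    ∑ i : Fin N, (if (i : ℕ) < B then a else 0) = B * a := by
  rw [Fin.sum_univ_eq_sum_range (fun i => if i < B then a else 0) N, ← Finset.sum_filter]
  have h : (Finset.range N).filter (· < B) = Finset.range B := by
    ext i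
    simp only [Finset.mem_filter, Finset.mem_range]
    omega
  rw [h, Finset.sum_const, Finset.card_range, nsmul_eq_mul]

/-- Either the qualified length is `ℓ`, or it satisfies the defining inequality. -/
theorem qualLen_eq_or_lt (N : ℕ) (c : Fin N → ℝ) (ℓ : ℕ) (θ : ℝ) :
    qualLen N c ℓ θ = ℓ ∨ ∃ hj : qualLen N c ℓ θ < N,
      c ⟨qualLen N c ℓ θ, hj⟩ ^ 2 < θ * tailSum N c (qualLen N c ℓ θ) := by
  have hne : ({j : ℕ | ∃ hj : j < N, j < ℓ ∧ c ⟨j, hj⟩ ^ 2 < θ * tailSum N c j} ∪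
      {ℓ}).Nonempty := ⟨ℓ, Or.inr rfl⟩
  rcases Nat.sInf_mem hne with ⟨hj, -, h⟩ | h
  · exact Or.inr ⟨hj, h⟩
  · exact Or.inl h

/-- If `c̃` is the restriction of `c` to a prefix `{0,…,m-1}` with
`m(c,B,ε/(B(1+ε))) ≤ m ≤ B`, then the taxicab error satisfies
`‖c − c̃‖₁ ≤ (1 + √(B·ε))·‖c − c_opt‖₁`. -/
theorem taxicab_heavy_hitters (N B : ℕ) (hN : 0 < N) (hB : 0 < B) (hBN : B ≤ N)
    (c : Fin N → ℝ)
    (hsorted : ∀ i j : Fin N, i ≤ j → |c j| ≤ |c i|)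
    (ε : ℝ) (hε : 0 < ε) (m : ℕ)
    (hm₁ : qualLen N c B (ε / (B * (1 + ε))) ≤ m) (hm₂ : m ≤ B) :
    ∑ i : Fin N, |c i - (if (i : ℕ) < m then c i else 0)|
      ≤ (1 + Real.sqrt (B * ε)) *
        ∑ i : Fin N, |c i - (if (i : ℕ) < B then c i else 0)| := by
  set L : ℝ := ∑ i : Fin N, |c i - (if (i : ℕ) < B then c i else 0)| with hL
  have hL0 : 0 ≤ L := Finset.sum_nonneg fun i _ => abs_nonneg _
  have hs0 := Real.sqrt_nonneg (B * ε)
  rcases qualLen_eq_or_lt N c B (ε / (B * (1 + ε))) with hq | ⟨hqN, hq⟩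
  · obtain rfl : m = B := le_antisymm hm₂ (hq ▸ hm₁)
    nlinarith [mul_nonneg hs0 hL0]
  set q := qualLen N c B (ε / (B * (1 + ε)))
  set a : ℝ := |c ⟨q, hqN⟩| with ha
  have ha0 : 0 ≤ a := abs_nonneg _
  have hle (i : Fin N) (hi : q ≤ i) : |c i| ≤ a := hsorted ⟨q, hqN⟩ i hi
  have hB' : (0 : ℝ) < B := by exact_mod_cast hB
  have htail : tailSum N c q ≤ B * a ^ 2 + L ^ 2 := by
    have hsq : ∑ i : Fin N, |c i - (if (i : ℕ) < B then c i else 0)| ^ 2 ≤ L ^ 2 :=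
      Finset.sum_sq_le_sq_sum_of_nonneg fun i _ => abs_nonneg _
    refine le_trans ?_ (add_le_add_right hsq _)
    rw [← Fin.sum_ite_val_lt_const hBN, ← Finset.sum_add_distrib, tailSum, Finset.sum_filter]
    refine Finset.sum_le_sum fun i _ => ?_
    by_cases hi : (i : ℕ) < B <;> by_cases hqi : q ≤ (i : ℕ)
    · simpa [hi, hqi] using pow_le_pow_left₀ (abs_nonneg _) (hle i hqi) 2
    · simpa [hi, hqi] using sq_nonneg a
    · simp [hi, hqi]
    · simpa [hi, hqi] using sq_nonneg (c i)
  have hsplit : ∑ i : Fin N, |c i - (if (i : ℕ) < m then c i else 0)| ≤ B * a + L := by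
    rw [← Fin.sum_ite_val_lt_const hBN, hL, ← Finset.sum_add_distrib]
    refine Finset.sum_le_sum fun i _ => ?_
    by_cases hi : (i : ℕ) < B <;> by_cases him : (i : ℕ) < m
    · simpa [hi, him] using ha0
    · simpa [hi, him] using hle i (by omega)
    · omega
    · simp [hi, him]
  have hhead : B * a ^ 2 ≤ ε * L ^ 2 := by
    rw [← sq_abs, ← ha, div_mul_eq_mul_div, lt_div_iff₀ (by positivity)] at hq
    nlinarith [mul_le_mul_of_nonneg_left htail hε.le]
  have hBa : B * a ≤ Real.sqrt (B * ε) * L := by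
    refine abs_le_of_sq_le_sq' ?_ (mul_nonneg hs0 hL0) |>.2
    rw [mul_pow, mul_pow, Real.sq_sqrt (by positivity)]
    nlinarith [mul_le_mul_of_nonneg_left hhead hB'.le]
  linarith
end

section
/- Let r = (r_0,…,r_{N−1}) be random variables taking values in {−1,+1}, each uniformly distributed, and pairwise independent. Fix a vector c : Fin N → ℝ and an index j, and let X = r_j · Σ_{i=0}^{N−1} r_i c_i. Then E[X] = c_j and Var[X] ≤ ‖c‖₂², where ‖c‖₂² = Σ_i c_i². -/
open MeasureTheory ProbabilityTheory

/-- A uniform `±1`-valued random variable has mean zero. -/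
lemma integral_eq_zero_of_uniform_sign {Ω : Type*} [MeasurableSpace Ω] {μ : Measure Ω}
    [IsProbabilityMeasure μ] {s : Ω → ℝ} (hmeas : Measurable s)
    (hval : ∀ ω, s ω = 1 ∨ s ω = -1) (hunif : μ {ω | s ω = 1} = 1 / 2) :
    ∫ ω, s ω ∂μ = 0 := by
  have hset : MeasurableSet {ω | s ω = 1} := hmeas (measurableSet_singleton 1)
  have hs : s = fun ω => 2 * {ω | s ω = 1}.indicator (fun _ => (1 : ℝ)) ω - 1 := by
    funext ω
    rcases hval ω with h | h <;> norm_num [Set.indicator, h]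
  have hint : Integrable ({ω | s ω = 1}.indicator fun _ => (1 : ℝ)) μ :=
    (integrable_const 1).indicator hset
  rw [hs, integral_sub (hint.const_mul 2) (integrable_const 1), integral_const_mul,
    integral_indicator_const _ hset]
  simp [measureReal_def, hunif]

/-- Pairwise independent uniform signs are orthonormal in `L²`. -/
lemma integral_mul_of_pairwise_indep_uniform_sign {Ω ι : Type*} [MeasurableSpace Ω]
    [DecidableEq ι] {μ : Measure Ω} [IsProbabilityMeasure μ] {r : ι → Ω → ℝ}
    (hmeas : ∀ i, Measurable (r i)) (hval : ∀ i, ∀ ω, r i ω = 1 ∨ r i ω = -1)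
    (hunif : ∀ i, μ {ω | r i ω = 1} = 1 / 2)
    (hpind : ∀ i i', i ≠ i' → IndepFun (r i) (r i') μ) (i k : ι) :
    ∫ ω, r i ω * r k ω ∂μ = if i = k then 1 else 0 := by
  split_ifs with h
  · subst h
    have hone : ∀ ω, r i ω * r i ω = 1 := fun ω => mul_self_eq_one_iff.mpr (hval i ω)
    simp [hone]
  · rw [(hpind i k h).integral_fun_mul_eq_mul_integral (hmeas i).aestronglyMeasurable
      (hmeas k).aestronglyMeasurable,
      integral_eq_zero_of_uniform_sign (hmeas i) (hval i) (hunif i), zero_mul]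

/-- Unbiasedness and variance bound for the sketch-based coefficient estimator
`X = r_j · ∑_i r_i c_i`, where the `r_i` are uniform `±1`-valued and pairwise
independent random variables: `E[X] = c_j` and `Var[X] ≤ ‖c‖₂²`. -/
theorem sketch_estimator_unbiased_and_variance
    {Ω : Type*} [MeasurableSpace Ω] (μ : Measure Ω) [IsProbabilityMeasure μ]
    (N : ℕ) (r : Fin N → Ω → ℝ)
    (hmeas : ∀ i, Measurable (r i))
    (hval : ∀ i, ∀ ω, r i ω = 1 ∨ r i ω = -1)
    (hunif : ∀ i, μ {ω | r i ω = 1} = 1 / 2)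
    (hpind : ∀ i i' : Fin N, i ≠ i' → IndepFun (r i) (r i') μ)
    (c : Fin N → ℝ) (j : Fin N) :
    (∫ ω, (r j ω * ∑ i : Fin N, r i ω * c i) ∂μ = c j)
    ∧ variance (fun ω => r j ω * ∑ i : Fin N, r i ω * c i) μ
        ≤ ∑ i : Fin N, c i ^ 2 := by
  have hint : ∀ i k, Integrable (fun ω => r i ω * r k ω) μ := fun i k =>
    .of_bound ((hmeas i).mul (hmeas k)).aestronglyMeasurable 1 <| .of_forall fun ω => by
      rcases hval i ω with h | h <;> rcases hval k ω with h' | h' <;> simp [h, h']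
  have horth := integral_mul_of_pairwise_indep_uniform_sign hmeas hval hunif hpind
  constructor
  · simp_rw [Finset.mul_sum, ← mul_assoc]
    rw [integral_finsetSum _ fun i _ => (hint j i).mul_const (c i)]
    simp [integral_mul_const, horth]
  · refine (variance_le_expectation_sq (by fun_prop)).trans_eq ?_
    have hsq : ∀ ω, (r j ω * ∑ i, r i ω * c i) ^ 2
        = ∑ i, ∑ k, r i ω * r k ω * (c i * c k) := fun ω => by
      rw [mul_pow, sq (r j ω), mul_self_eq_one_iff.mpr (hval j ω), one_mul, sq, Finset.sum_mul_sum]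
      simp_rw [mul_mul_mul_comm]
    simp only [Pi.pow_apply, hsq]
    rw [integral_finsetSum _ fun i _ =>
      integrable_finsetSum _ fun k _ => (hint i k).mul_const (c i * c k)]
    refine Finset.sum_congr rfl fun i _ => ?_
    rw [integral_finsetSum _ fun k _ => (hint i k).mul_const (c i * c k)]
    simp [integral_mul_const, horth, sq]
end

section
/- The qualified index set Q_{c,B,θ} is determined by the top-B terms of c together with the Euclidean norm of c: if c and d are two vectors (each sorted in weakly decreasing order of magnitude) such that c_j = d_j for all j < B and ‖c‖₂ = ‖d‖₂, then for every θ > 0, m(c,B,θ) = m(d,B,θ), i.e., Q_{c,B,θ} = Q_{d,B,θ}. -/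
/-- The tail sum is the full sum of squares minus the sum of the first `j` squares. -/
theorem tailSum_eq_sub (N : ℕ) (c : Fin N → ℝ) (j : ℕ) :
    tailSum N c j = ∑ i : Fin N, c i ^ 2 -
      ∑ i ∈ Finset.univ.filter (fun i : Fin N => ¬ j ≤ (i : ℕ)), c i ^ 2 :=
  eq_sub_of_add_eq (Finset.sum_filter_add_sum_filter_not _ _ _)

/-- Vectors with equal sums of squares that agree below `j` have equal tail sums at `j`. -/
theorem tailSum_congr {N : ℕ} {c d : Fin N → ℝ} {j : ℕ}
    (hagree : ∀ i : Fin N, (i : ℕ) < j → c i = d i)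
    (hsum : ∑ i : Fin N, c i ^ 2 = ∑ i : Fin N, d i ^ 2) :
    tailSum N c j = tailSum N d j := by
  rw [tailSum_eq_sub, tailSum_eq_sub, hsum]
  congr 1
  refine Finset.sum_congr rfl fun i hi => ?_
  rw [hagree i (not_le.mp (Finset.mem_filter.mp hi).2)]

/-- The qualified index set `Q_{c,B,θ}` is determined by the top-`B` terms of `c`
together with the Euclidean norm of `c`: two sorted vectors agreeing on the first
`B` entries and having the same Euclidean norm have the same qualified length for
every `θ > 0`. -/
theorem qualified_determined_by_top_and_norm (N B : ℕ) (hN : 0 < N) (hB : 0 < B)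
    (hBN : B ≤ N)
    (c d : Fin N → ℝ)
    (hc_sorted : ∀ i j : Fin N, i ≤ j → |c j| ≤ |c i|)
    (hd_sorted : ∀ i j : Fin N, i ≤ j → |d j| ≤ |d i|)
    (hagree : ∀ j : Fin N, (j : ℕ) < B → c j = d j)
    (hnorm : Real.sqrt (∑ i : Fin N, c i ^ 2) = Real.sqrt (∑ i : Fin N, d i ^ 2))
    (θ : ℝ) (hθ : 0 < θ) :
    qualLen N c B θ = qualLen N d B θ := by
  have hsum : ∑ i : Fin N, c i ^ 2 = ∑ i : Fin N, d i ^ 2 :=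
    (Real.sqrt_inj (Finset.sum_nonneg fun i _ => sq_nonneg (c i))
      (Finset.sum_nonneg fun i _ => sq_nonneg (d i))).mp hnorm
  unfold qualLen
  congr 2
  ext j
  refine exists_congr fun hj => and_congr_right fun hjB => ?_
  rw [hagree ⟨j, hj⟩ hjB, tailSum_congr (fun i hi => hagree i (hi.trans hjB)) hsum]
end
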